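/- arXiv:2501.06127 — 2 statements merged into one kernel-verified Lean document; each statement's English description precedes it below -/
import Mathlib

section
/- Let n ≥ 1 be an integer and let u : ℝ → ℝ be n-times continuously differentiable on [0, ∞), and suppose there exist constants M > 0 and k ∈ ℝ such that |u^{(j)}(t)| ≤ M e^{k t} for all t ≥ 0 and all 0 ≤ j ≤ n. Then for every s > max(k, 0), the Aboodh transform of the n-th derivative satisfies A[u^{(n)}](s) = sⁿ·A[u](s) − Σ_{j=0}^{n−1} u^{(j)}(0) / s^{2−n+j}. -/
open MeasureTheory Real Set

/-- A function of exponential order `k` on `[0, ∞)` has an absolutely convergent Laplace integral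
at every `s > k`. -/
theorem integrableOn_mul_exp_of_abs_le {v : ℝ → ℝ} {M k s : ℝ} (hks : k < s)
    (hv : ContinuousOn v (Ici 0)) (hb : ∀ t, 0 ≤ t → |v t| ≤ M * exp (k * t)) :
    IntegrableOn (fun t => v t * exp (-(s * t))) (Ici 0) := by
  have hdom : IntegrableOn (fun t => M * exp (-(s - k) * t)) (Ici (0 : ℝ)) :=
    ((integrableOn_Ici_iff_integrableOn_Ioi (by simp)).2
      (exp_neg_integrableOn_Ioi 0 (sub_pos.2 hks))).const_mul M
  refine hdom.mono' ((hv.mul (by fun_prop)).aestronglyMeasurable measurableSet_Ici) ?_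
  refine (ae_restrict_mem measurableSet_Ici).mono fun t ht => ?_
  rw [norm_eq_abs, abs_mul, abs_exp]
  calc |v t| * exp (-(s * t)) ≤ M * exp (k * t) * exp (-(s * t)) := by gcongr; exact hb t ht
    _ = M * exp (-(s - k) * t) := by rw [mul_assoc, ← exp_add]; ring_nf

/-- A function of exponential order `k`, damped by `exp (-(s * t))` with `s > k`, tends to `0`. -/
theorem tendsto_mul_exp_of_abs_le {v : ℝ → ℝ} {M k s : ℝ} (hks : k < s)
    (hb : ∀ t, 0 ≤ t → |v t| ≤ M * exp (k * t)) :
    Filter.Tendsto (fun t => v t * exp (-(s * t))) Filter.atTop (nhds 0) := by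
  have hlim : Filter.Tendsto (fun t => M * exp (-((s - k) * t))) Filter.atTop (nhds 0) := by
    simpa using (tendsto_exp_neg_atTop_nhds_zero.comp
      (Filter.tendsto_id.const_mul_atTop (sub_pos.2 hks))).const_mul M
  refine squeeze_zero_norm' ((Filter.eventually_ge_atTop 0).mono fun t ht => ?_) hlim
  rw [norm_eq_abs, abs_mul, abs_exp]
  calc |v t| * exp (-(s * t)) ≤ M * exp (k * t) * exp (-(s * t)) := by gcongr; exact hb t ht
    _ = M * exp (-((s - k) * t)) := by rw [mul_assoc, ← exp_add]; ring_nf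

/-- The Laplace integral of a derivative. -/
theorem integral_deriv_mul_exp {v v' : ℝ → ℝ} {M k s : ℝ} (hks : k < s)
    (hv : ContinuousOn v (Ici 0)) (hv' : ContinuousOn v' (Ici 0))
    (hd : ∀ t, 0 < t → HasDerivAt v (v' t) t)
    (hb : ∀ t, 0 ≤ t → |v t| ≤ M * exp (k * t))
    (hb' : ∀ t, 0 ≤ t → |v' t| ≤ M * exp (k * t)) :
    ∫ t in Ici (0 : ℝ), v' t * exp (-(s * t)) =
      s * (∫ t in Ici (0 : ℝ), v t * exp (-(s * t))) - v 0 := by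
  have hi := (integrableOn_mul_exp_of_abs_le hks hv hb).const_mul s
  have hi' := integrableOn_mul_exp_of_abs_le hks hv' hb'
  have key := integral_Ioi_of_hasDerivAt_of_tendsto (a := 0)
    (f := fun t => v t * exp (-(s * t)))
    (f' := fun t => v' t * exp (-(s * t)) - s * (v t * exp (-(s * t))))
    ((hv 0 self_mem_Ici).mul (by fun_prop))
    (fun t ht => by
      have he : HasDerivAt (fun t => exp (-(s * t))) (exp (-(s * t)) * -(s * 1)) t :=
        ((hasDerivAt_id t).const_mul s).neg.exp
      exact ((hd t ht).mul he).congr_deriv (by ring))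
    ((hi'.sub hi).mono_set Ioi_subset_Ici_self)
    (tendsto_mul_exp_of_abs_le hks hb)
  rw [← integral_Ici_eq_integral_Ioi, integral_sub hi' hi, integral_const_mul] at key
  simp only [mul_zero, neg_zero, exp_zero, mul_one] at key
  linarith

/-- Aboodh transform of the n-th derivative:
`A[u^{(n)}](s) = s^n * A[u](s) - ∑_{j=0}^{n-1} u^{(j)} 0 / s^(2-n+j)`. -/
theorem aboodh_iteratedDeriv (n : ℕ) (hn : 1 ≤ n) (u : ℝ → ℝ)
    (hu : ContDiffOn ℝ n u (Set.Ici 0))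
    (M k : ℝ) (hM : 0 < M)
    (hb : ∀ j : ℕ, j ≤ n → ∀ t : ℝ, 0 ≤ t →
      |iteratedDerivWithin j u (Set.Ici 0) t| ≤ M * Real.exp (k * t)) :
    ∀ s : ℝ, max k 0 < s →
      (1 / s) * ∫ t in Set.Ici (0 : ℝ),
          iteratedDerivWithin n u (Set.Ici 0) t * Real.exp (-(s * t)) =
        s ^ n * ((1 / s) * ∫ t in Set.Ici (0 : ℝ), u t * Real.exp (-(s * t))) -
          ∑ j ∈ Finset.range n,
            iteratedDerivWithin j u (Set.Ici 0) 0 / s ^ (2 - (n : ℤ) + (j : ℤ)) := by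
  intro s hs
  have hks : k < s := (le_max_left k 0).trans_lt hs
  have hs0 : s ≠ 0 := ((le_max_right k 0).trans_lt hs).ne'
  have hU : UniqueDiffOn ℝ (Ici (0 : ℝ)) := uniqueDiffOn_Ici 0
  have hcont : ∀ j ≤ n, ContinuousOn (iteratedDerivWithin j u (Ici 0)) (Ici 0) := fun j hj =>
    hu.continuousOn_iteratedDerivWithin (by exact_mod_cast hj) hU
  have hderiv : ∀ j < n, ∀ t, 0 < t → HasDerivAt (iteratedDerivWithin j u (Ici 0))
      (iteratedDerivWithin (j + 1) u (Ici 0) t) t := fun j hj t ht => by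
    rw [iteratedDerivWithin_succ]
    exact ((hu.differentiableOn_iteratedDerivWithin (by exact_mod_cast hj) hU) t
      ht.le).hasDerivWithinAt.hasDerivAt (Ici_mem_nhds ht)
  have key : ∀ m ≤ n, (1 / s) * ∫ t in Ici (0 : ℝ),
        iteratedDerivWithin m u (Ici 0) t * exp (-(s * t)) =
      s ^ m * ((1 / s) * ∫ t in Ici (0 : ℝ), u t * exp (-(s * t))) -
        ∑ j ∈ Finset.range m,
          iteratedDerivWithin j u (Ici 0) 0 / s ^ (2 - (m : ℤ) + (j : ℤ)) := by
    intro m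
    induction m with
    | zero => simp
    | succ m ih =>
      intro hm
      have hsum : ∑ j ∈ Finset.range m,
            iteratedDerivWithin j u (Ici 0) 0 / s ^ (2 - ((m + 1 : ℕ) : ℤ) + (j : ℤ)) =
          s * ∑ j ∈ Finset.range m,
            iteratedDerivWithin j u (Ici 0) 0 / s ^ (2 - (m : ℤ) + (j : ℤ)) := by
        rw [Finset.mul_sum]
        refine Finset.sum_congr rfl fun j _ => ?_
        rw [show 2 - (m : ℤ) + j = (2 - ((m + 1 : ℕ) : ℤ) + j) + 1 by push_cast; ring,
          zpow_add_one₀ hs0]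
        field_simp
      have hlast : 2 - ((m + 1 : ℕ) : ℤ) + (m : ℤ) = 1 := by push_cast; ring
      rw [integral_deriv_mul_exp hks (hcont m (by omega)) (hcont (m + 1) hm) (hderiv m hm)
        (hb m (by omega)) (hb (m + 1) hm), Finset.sum_range_succ, hsum, hlast, zpow_one, pow_succ]
      linear_combination s * ih (by omega)
  exact key n le_rfl
end

section
/- Let f : ℝ → ℝ be continuous on [0, ∞) with |f(t)| ≤ M e^{k t} for all t ≥ 0 for some constants M > 0 and k ∈ ℝ, and let β > 0. Then for every s > max(k, 0), the Aboodh transform of the Riemann–Liouville fractional integral of f of order β satisfies A[J^β f](s) = s^{−β} · A[f](s); that is, (1/s) ∫₀^∞ e^{−s t} [(1/Γ(β)) ∫₀ᵗ (t−κ)^{β−1} f(κ) dκ] dt = (1/s^{β+1}) ∫₀^∞ f(t) e^{−s t} dt. -/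
open MeasureTheory Real Set intervalIntegral

/-- The Laplace integrand of a continuous function of exponential order `k` is integrable on
`(0, ∞)` for every parameter `s > k`. -/
theorem integrableOn_mul_exp_neg_of_exponential_bound {f : ℝ → ℝ}
    (hf : ContinuousOn f (Set.Ici 0)) {M k s : ℝ}
    (hb : ∀ t : ℝ, 0 ≤ t → |f t| ≤ M * Real.exp (k * t)) (hs : k < s) :
    IntegrableOn (fun t => f t * Real.exp (-(s * t))) (Set.Ioi 0) := by
  refine Integrable.mono' ((integrableOn_exp_mul_Ioi (sub_neg.mpr hs) 0).const_mul M) ?_ ?_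
  · exact ((hf.mono Ioi_subset_Ici_self).mul (by fun_prop)).aestronglyMeasurable measurableSet_Ioi
  · refine (ae_restrict_iff' measurableSet_Ioi).mpr (ae_of_all _ fun t ht => ?_)
    rw [norm_mul, Real.norm_eq_abs, Real.norm_eq_abs, Real.abs_exp,
      show (k - s) * t = k * t + -(s * t) by ring, Real.exp_add, ← mul_assoc]
    gcongr
    exact hb t (le_of_lt ht)

/-- Aboodh transform of the Riemann–Liouville fractional integral:
`A[J^β f](s) = s^{-β} * A[f](s)`. -/
theorem aboodh_riemannLiouville (f : ℝ → ℝ)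
    (hf : ContinuousOn f (Set.Ici 0))
    (M k : ℝ) (hM : 0 < M)
    (hb : ∀ t : ℝ, 0 ≤ t → |f t| ≤ M * Real.exp (k * t))
    (β : ℝ) (hβ : 0 < β) :
    ∀ s : ℝ, max k 0 < s →
      (1 / s) * ∫ t in Set.Ioi (0 : ℝ),
          Real.exp (-(s * t)) *
            ((1 / Real.Gamma β) * ∫ κ in (0 : ℝ)..t, (t - κ) ^ (β - 1) * f κ) =
        (1 / s ^ (β + 1)) * ∫ t in Set.Ioi (0 : ℝ), f t * Real.exp (-(s * t)) := by
  intro s hs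
  obtain ⟨hks, hs0⟩ := max_lt_iff.mp hs
  have hΓ : 0 < Real.Gamma β := Real.Gamma_pos_of_pos hβ
  have hkernel := Real.integral_rpow_mul_exp_neg_mul_Ioi hβ hs0
  have hconv := integral_posConvolution (μ := volume) (ν := volume)
    (integrableOn_mul_exp_neg_of_exponential_bound hf hb hks)
    (g := fun t => t ^ (β - 1) * Real.exp (-(s * t)))
    (.of_integral_ne_zero (by rw [hkernel]; positivity)) (ContinuousLinearMap.mul ℝ ℝ)
  simp_rw [ContinuousLinearMap.mul_apply'] at hconv
  rw [hkernel] at hconv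
  have hintegrand (t : ℝ) :
      Real.exp (-(s * t)) *
          ((1 / Real.Gamma β) * ∫ κ in (0 : ℝ)..t, (t - κ) ^ (β - 1) * f κ) =
        (1 / Real.Gamma β) * ∫ κ in (0 : ℝ)..t,
          f κ * Real.exp (-(s * κ)) * ((t - κ) ^ (β - 1) * Real.exp (-(s * (t - κ)))) := by
    rw [mul_left_comm, ← intervalIntegral.integral_const_mul]
    congr 2 with κ
    rw [show -(s * t) = -(s * κ) + -(s * (t - κ)) by ring, Real.exp_add]
    ring
  simp_rw [hintegrand]
  rw [MeasureTheory.integral_const_mul, hconv, Real.rpow_add_one hs0.ne',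
    Real.div_rpow zero_le_one hs0.le, Real.one_rpow]
  field_simp
end
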